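/- Let f be an operator (1,h)-convex function on ℝ⁺ with f(0) = 0, where h is a nonnegative non-zero super-multiplicative function on an interval J ⊆ ℝ⁺ containing (0,1) satisfying 2 h(1/2) ≤ h(α)/α for all α ∈ (0,1) and 2 h(1/2) ≤ 1. Then the function t ↦ t⁻¹ f(t) is operator monotone on (0,∞); that is, for all positive definite matrices A ≤ B, A⁻¹ f(A) ≤ B⁻¹ f(B). -/

import Mathlib

open Matrix
open scoped ComplexOrder

/-- The matrix `A` raised to the real power `p`, defined via the continuous
functional calculus (using the real power function `Real.rpow`). -/
noncomputable def mpow {n : ℕ} (A : Matrix (Fin n) (Fin n) ℂ) (p : ℝ) :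
    Matrix (Fin n) (Fin n) ℂ :=
  cfc (fun x : ℝ => x ^ p) A

/-- The Loewner order on matrices: `loewnerLE X Y` iff `Y - X` is positive semidefinite. -/
def loewnerLE {n : ℕ} (X Y : Matrix (Fin n) (Fin n) ℂ) : Prop :=
  (Y - X).PosSemidef

/-- A set `K ⊆ ℝ` is `p`-convex if `(l*x^p + (1-l)*y^p)^(1/p) ∈ K` for all
`x, y ∈ K` and `l ∈ [0,1]`. -/
def PConvex (p : ℝ) (K : Set ℝ) : Prop :=
  ∀ x ∈ K, ∀ y ∈ K, ∀ l ∈ Set.Icc (0 : ℝ) 1,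
    (l * x ^ p + (1 - l) * y ^ p) ^ (1 / p) ∈ K

/-- `h` is super-multiplicative on `J`: `h (x*y) ≥ h x * h y` for all `x, y ∈ J`. -/
def SuperMultiplicativeOn (J : Set ℝ) (h : ℝ → ℝ) : Prop :=
  ∀ x ∈ J, ∀ y ∈ J, h x * h y ≤ h (x * y)

/-- `f` is operator `(p,h)`-convex on `K`: `f` is nonnegative and continuous on `K`, and
`f([α A^p + (1-α) B^p]^{1/p}) ≤ h(α) f(A) + h(1-α) f(B)` (in the Loewner order) for all
positive semidefinite matrices `A, B` (of any order `n`) with spectra in `K` and all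
`α ∈ (0,1)`, where matrix functions are taken via the continuous functional calculus. -/
def OperatorPHConvexOn (p : ℝ) (K : Set ℝ) (h : ℝ → ℝ) (f : ℝ → ℝ) : Prop :=
  (∀ x ∈ K, 0 ≤ f x) ∧ ContinuousOn f K ∧
  ∀ (n : ℕ) (A B : Matrix (Fin n) (Fin n) ℂ),
    A.PosSemidef → B.PosSemidef → spectrum ℝ A ⊆ K → spectrum ℝ B ⊆ K →
    ∀ α ∈ Set.Ioo (0 : ℝ) 1,
      loewnerLE (cfc f (mpow (α • mpow A p + (1 - α) • mpow B p) (1 / p)))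
        (h α • cfc f A + h (1 - α) • cfc f B)

/-- In the Hermitian functional calculus on matrices, an intertwiner of `Y` and `Z` also
intertwines `cfc f Y` and `cfc f Z`. -/
lemma Matrix.IsHermitian.cfc_mul_eq_mul_cfc {m n : ℕ} {Y : Matrix (Fin m) (Fin m) ℂ}
    {Z : Matrix (Fin n) (Fin n) ℂ} (hY : Y.IsHermitian) (hZ : Z.IsHermitian)
    {W : Matrix (Fin m) (Fin n) ℂ} (hW : Y * W = W * Z) (f : ℝ → ℝ) :
    cfc f Y * W = W * cfc f Z := by
  have hfin : (spectrum ℝ Y ∪ spectrum ℝ Z).Finite :=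
    Y.finite_real_spectrum.union Z.finite_real_spectrum
  let p : Polynomial ℝ := Lagrange.interpolate hfin.toFinset id f
  have hp : ∀ x ∈ spectrum ℝ Y ∪ spectrum ℝ Z, f x = p.eval x := fun x hx =>
    (Lagrange.eval_interpolate_at_node f (Set.injOn_id _) (hfin.mem_toFinset.2 hx)).symm
  rw [cfc_congr fun x hx => hp x (Or.inl hx), cfc_congr fun x hx => hp x (Or.inr hx),
    cfc_polynomial p Y hY.isSelfAdjoint,
    cfc_polynomial p Z hZ.isSelfAdjoint]
  induction p using Polynomial.induction_on' with
  | add p q hp hq => simp only [map_add, Matrix.add_mul, Matrix.mul_add, hp, hq]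
  | monomial k a =>
    have hk : Y ^ k * W = W * Z ^ k := by
      induction k with
      | zero => simp
      | succ k ih => rw [pow_succ, Matrix.mul_assoc, hW, ← Matrix.mul_assoc, ih,
          Matrix.mul_assoc, ← pow_succ]
    simp only [Polynomial.aeval_monomial, ← Algebra.smul_def, Matrix.smul_mul,
      Matrix.mul_smul, hk]

lemma mpow_one_eq {n : ℕ} {A : Matrix (Fin n) (Fin n) ℂ} (hA : A.IsHermitian) :
    mpow A 1 = A := by
  simp only [mpow, Real.rpow_one]
  exact cfc_id' ℝ A hA

lemma Matrix.PosSemidef.spectrum_subset_Ici {n : ℕ} {A : Matrix (Fin n) (Fin n) ℂ}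
    (hA : A.PosSemidef) : spectrum ℝ A ⊆ Set.Ici 0 := by
  rw [hA.1.spectrum_real_eq_range_eigenvalues]
  rintro _ ⟨i, rfl⟩
  exact hA.eigenvalues_nonneg i

lemma Matrix.posSemidef_cfc {n : ℕ} {A : Matrix (Fin n) (Fin n) ℂ} {f : ℝ → ℝ}
    (hA : A.PosSemidef) (hf : ∀ x ∈ Set.Ici (0 : ℝ), 0 ≤ f x) : (cfc f A).PosSemidef := by
  open scoped MatrixOrder in
  exact Matrix.nonneg_iff_posSemidef.1
    (cfc_nonneg fun x hx => hf x (hA.spectrum_subset_Ici hx))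

lemma OperatorPHConvexOn.midpoint {h f : ℝ → ℝ} (hf : OperatorPHConvexOn 1 (Set.Ici 0) h f)
    (hh : 2 * h (1 / 2) ≤ 1) {n : ℕ} {A B : Matrix (Fin n) (Fin n) ℂ}
    (hA : A.PosSemidef) (hB : B.PosSemidef) :
    ((1 / 2 : ℝ) • (cfc f A + cfc f B) - cfc f ((1 / 2 : ℝ) • (A + B))).PosSemidef := by
  have key := hf.2.2 n A B hA hB hA.spectrum_subset_Ici hB.spectrum_subset_Ici (1 / 2)
    ⟨by norm_num, by norm_num⟩
  have hM : ((1 / 2 : ℝ) • (A + B)).PosSemidef := (hA.add hB).smul (by norm_num)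
  have h12 : (1 - 1 / 2 : ℝ) = 1 / 2 := by norm_num
  rw [loewnerLE, mpow_one_eq hA.1, mpow_one_eq hB.1, h12, ← smul_add, ← smul_add,
    one_div_one, mpow_one_eq hM.1] at key
  have hrest : ((1 / 2 - h (1 / 2)) • (cfc f A + cfc f B)).PosSemidef :=
    ((posSemidef_cfc hA hf.1).add (posSemidef_cfc hB hf.1)).smul (by linarith)
  convert key.add hrest using 1
  module

/-- Jensen's operator inequality for the compression by an isometry. -/
lemma OperatorPHConvexOn.isometry_compression {h f : ℝ → ℝ}
    (hf : OperatorPHConvexOn 1 (Set.Ici 0) h f) (hh : 2 * h (1 / 2) ≤ 1) {m n : ℕ}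
    {X : Matrix (Fin m) (Fin m) ℂ} (hX : X.PosSemidef) {W : Matrix (Fin m) (Fin n) ℂ}
    (hW : Wᴴ * W = 1) : (Wᴴ * cfc f X * W - cfc f (Wᴴ * X * W)).PosSemidef := by
  set U : Matrix (Fin m) (Fin m) ℂ := (2 : ℝ) • (W * Wᴴ) - 1 with hU
  have hUH : Uᴴ = U := by simp [hU]
  have hUW : U * W = W := by
    rw [hU, Matrix.sub_mul, Matrix.smul_mul, Matrix.mul_assoc, hW, Matrix.mul_one,
      Matrix.one_mul]
    module
  have hWU : Wᴴ * U = Wᴴ := by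
    simpa [hUH] using congrArg conjTranspose hUW
  have hUU : U * U = 1 := by
    nth_rw 1 [hU]
    rw [Matrix.sub_mul, Matrix.smul_mul, Matrix.mul_assoc, hWU, Matrix.one_mul, hU]
    module
  have hX' : (U * X * U).PosSemidef := by
    simpa [hUH] using hX.conjTranspose_mul_mul_same U
  have hM : ((1 / 2 : ℝ) • (X + U * X * U)).PosSemidef := (hX.add hX').smul (by norm_num)
  have hZ : (Wᴴ * X * W).PosSemidef := hX.conjTranspose_mul_mul_same W
  have hfU : cfc f (U * X * U) * U = U * cfc f X :=
    hX'.1.cfc_mul_eq_mul_cfc hX.1 (by rw [Matrix.mul_assoc, hUU, Matrix.mul_one]) f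
  have hfW : cfc f ((1 / 2 : ℝ) • (X + U * X * U)) * W = W * cfc f (Wᴴ * X * W) := by
    refine hM.1.cfc_mul_eq_mul_cfc hZ.1 ?_ f
    rw [Matrix.smul_mul, Matrix.add_mul, Matrix.mul_assoc (U * X), hUW, Matrix.mul_assoc U,
      hU, Matrix.sub_mul, Matrix.one_mul, Matrix.smul_mul]
    simp only [Matrix.mul_assoc]
    module
  have hWf : Wᴴ * cfc f (U * X * U) * W = Wᴴ * cfc f X * W := by
    nth_rw 2 [← hUW]
    rw [Matrix.mul_assoc, ← Matrix.mul_assoc (cfc f (U * X * U)), hfU, Matrix.mul_assoc U,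
      ← Matrix.mul_assoc, hWU, Matrix.mul_assoc]
  have key := (hf.midpoint hh hX hX').conjTranspose_mul_mul_same W
  rw [Matrix.mul_sub, Matrix.sub_mul, Matrix.mul_assoc _ _ W, Matrix.mul_assoc _ _ W, hfW,
    ← Matrix.mul_assoc _ W, hW, Matrix.one_mul, Matrix.smul_mul, Matrix.add_mul,
    Matrix.mul_smul, Matrix.mul_add, ← Matrix.mul_assoc, ← Matrix.mul_assoc, hWf] at key
  convert key using 2
  module

/-- Jensen's operator inequality for contractions, when `f 0 = 0`. -/
lemma OperatorPHConvexOn.contraction_compression {h f : ℝ → ℝ}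
    (hf : OperatorPHConvexOn 1 (Set.Ici 0) h f) (hh : 2 * h (1 / 2) ≤ 1) (hf0 : f 0 = 0)
    {n : ℕ} {X K : Matrix (Fin n) (Fin n) ℂ} (hX : X.PosSemidef)
    (hK : (1 - Kᴴ * K).PosSemidef) : (Kᴴ * cfc f X * K - cfc f (Kᴴ * X * K)).PosSemidef := by
  obtain ⟨E, hE⟩ : ∃ E : Matrix (Fin n) (Fin n) ℂ, 1 - Kᴴ * K = Eᴴ * E := by
    open scoped MatrixOrder Matrix.Norms.L2Operator in
    exact CStarAlgebra.nonneg_iff_eq_star_mul_self.1 hK.nonneg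
  obtain ⟨P, Q, hP, hQ, hPQ⟩ : ∃ P Q : Matrix (Fin (n + n)) (Fin n) ℂ,
      Pᴴ * P = 1 ∧ Qᴴ * Q = 1 ∧ Pᴴ * Q = 0 := by
    refine ⟨(1 : Matrix (Fin (n + n)) (Fin (n + n)) ℂ).submatrix id (Fin.castAdd n),
      (1 : Matrix (Fin (n + n)) (Fin (n + n)) ℂ).submatrix id (Fin.natAdd n), ?_, ?_, ?_⟩ <;>
    · ext i j
      simp only [Matrix.mul_apply, conjTranspose_apply, submatrix_apply, id, Matrix.one_apply,
        apply_ite star, star_one, star_zero, mul_ite, mul_one, mul_zero, Finset.sum_ite_eq',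
        Finset.mem_univ, if_true, Matrix.zero_apply]
      simp only [Fin.ext_iff, Fin.val_castAdd, Fin.val_natAdd]
      grind
  have hQP : Qᴴ * P = 0 := by simpa using congrArg conjTranspose hPQ
  have hW : (P * K + Q * E)ᴴ * (P * K + Q * E) = 1 := by
    have : ∀ (L M : Matrix (Fin (n + n)) (Fin n) ℂ) (S T : Matrix (Fin n) (Fin n) ℂ),
        Sᴴ * Lᴴ * (M * T) = Sᴴ * (Lᴴ * M) * T := fun L M S T => by
      simp only [Matrix.mul_assoc]
    simp [Matrix.add_mul, Matrix.mul_add, this, hP, hQ, hPQ, hQP, ← hE]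
  have hY : (P * X * Pᴴ).PosSemidef := hX.mul_mul_conjTranspose_same P
  have hfP : cfc f (P * X * Pᴴ) * P = P * cfc f X :=
    hY.1.cfc_mul_eq_mul_cfc hX.1 (by rw [Matrix.mul_assoc, hP, Matrix.mul_one]) f
  have hfQ : cfc f (P * X * Pᴴ) * Q = 0 := by
    rw [hY.1.cfc_mul_eq_mul_cfc (Z := (0 : Matrix (Fin n) (Fin n) ℂ)) (by simp [IsHermitian])
      (by rw [Matrix.mul_assoc, hPQ, Matrix.mul_zero, Matrix.mul_zero]) f, cfc_apply_zero, hf0]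
    simp
  have hPW : Pᴴ * (P * K + Q * E) = K := by
    rw [Matrix.mul_add, ← Matrix.mul_assoc, ← Matrix.mul_assoc, hP, hPQ]
    simp
  have hWP : (P * K + Q * E)ᴴ * P = Kᴴ := by simpa using congrArg conjTranspose hPW
  have key := hf.isometry_compression hh hY hW
  generalize hWdef : P * K + Q * E = W at *
  have hfW : cfc f (P * X * Pᴴ) * W = P * cfc f X * K := by
    rw [← hWdef, Matrix.mul_add, ← Matrix.mul_assoc, ← Matrix.mul_assoc, hfP, hfQ]
    simp
  have hcomp : Wᴴ * (P * X * Pᴴ) * W = Kᴴ * X * K := by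
    rw [← hWP, ← hPW]
    simp only [Matrix.mul_assoc]
  rw [hcomp, Matrix.mul_assoc, hfW, Matrix.mul_assoc P, ← Matrix.mul_assoc, hWP,
    ← Matrix.mul_assoc] at key
  exact key

/-- The square root of a positive definite matrix factors its functional calculus. -/
lemma Matrix.PosDef.exists_sqrt_factorization {n : ℕ} {A : Matrix (Fin n) (Fin n) ℂ}
    (hA : A.PosDef) (f : ℝ → ℝ) : ∃ R : Matrix (Fin n) (Fin n) ℂ, R.IsHermitian ∧ R * R = A ∧
      IsUnit R ∧ cfc f A = R * cfc (fun t : ℝ => t⁻¹ * f t) A * R := by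
  have hc : ∀ g : ℝ → ℝ, ContinuousOn g (spectrum ℝ A) := fun g =>
    A.finite_real_spectrum.continuousOn g
  have hpos : ∀ x ∈ spectrum ℝ A, 0 < x := by
    rw [hA.1.spectrum_real_eq_range_eigenvalues]
    rintro _ ⟨i, rfl⟩
    exact hA.eigenvalues_pos i
  have hRR : cfc Real.sqrt A * cfc Real.sqrt A = A := by
    rw [← cfc_mul _ _ A (hc _) (hc _)]
    conv_rhs => rw [← cfc_id' ℝ A hA.1]
    exact cfc_congr fun x hx => Real.mul_self_sqrt (hpos x hx).le
  refine ⟨cfc Real.sqrt A, cfc_predicate _ A, hRR, ?_, ?_⟩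
  · exact isUnit_of_mul_isUnit_left (hRR.symm ▸ hA.isUnit)
  · rw [← cfc_mul _ _ A (hc _) (hc _), ← cfc_mul _ _ A (hc _) (hc _)]
    refine cfc_congr fun x hx => ?_
    have h1 := Real.mul_self_sqrt (hpos x hx).le
    have h2 := (hpos x hx).ne'
    calc f x = x * x⁻¹ * f x := by rw [mul_inv_cancel₀ h2, one_mul]
      _ = (√x * √x) * x⁻¹ * f x := by rw [h1]
      _ = _ := by ring

/-- If `f` is operator `(1,h)`-convex on `ℝ⁺` with `f(0) = 0` and `2 h(1/2) ≤ 1`, then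
`t ↦ t⁻¹ f(t)` is operator monotone on `(0,∞)`: for positive definite `A ≤ B`,
`A⁻¹ f(A) ≤ B⁻¹ f(B)`. -/
theorem stmt18
    (J : Set ℝ) (hJ : Set.Ioo (0 : ℝ) 1 ⊆ J) (hJpos : J ⊆ Set.Ici 0)
    (h : ℝ → ℝ) (hh0 : ∀ x ∈ J, 0 ≤ h x) (hhne : ∃ x ∈ J, h x ≠ 0)
    (hsm : SuperMultiplicativeOn J h)
    (h2h : ∀ α ∈ Set.Ioo (0 : ℝ) 1, 2 * h (1 / 2) ≤ h α / α)
    (h2h1 : 2 * h (1 / 2) ≤ 1)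
    (f : ℝ → ℝ) (hf : OperatorPHConvexOn 1 (Set.Ici 0) h f) (hf0 : f 0 = 0) :
    ∀ (n : ℕ) (A B : Matrix (Fin n) (Fin n) ℂ), A.PosDef → B.PosDef → loewnerLE A B →
      loewnerLE (cfc (fun t : ℝ => t⁻¹ * f t) A) (cfc (fun t : ℝ => t⁻¹ * f t) B) := by
  intro n A B hA hB hAB
  obtain ⟨R, hRH, hRR, hRu, hfA⟩ := hA.exists_sqrt_factorization f
  obtain ⟨S, hSH, hSS, hSu, hfB⟩ := hB.exists_sqrt_factorization f
  have hRdet := (Matrix.isUnit_iff_isUnit_det R).1 hRu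
  have hSdet := (Matrix.isUnit_iff_isUnit_det S).1 hSu
  have hKH : (S⁻¹ * R)ᴴ = R * S⁻¹ := by
    rw [conjTranspose_mul, conjTranspose_nonsing_inv, hRH.eq, hSH.eq]
  have hcancel : ∀ M : Matrix (Fin n) (Fin n) ℂ,
      (S⁻¹ * R)ᴴ * (S * M * S) * (S⁻¹ * R) = R * M * R := fun M => by
    rw [hKH]
    calc R * S⁻¹ * (S * M * S) * (S⁻¹ * R) = R * (S⁻¹ * S) * M * (S * S⁻¹) * R := by
          simp only [Matrix.mul_assoc]
      _ = R * M * R := by simp [nonsing_inv_mul S hSdet, mul_nonsing_inv S hSdet]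
  have hK : (1 - (S⁻¹ * R)ᴴ * (S⁻¹ * R)).PosSemidef := by
    have hinv : (S⁻¹ * R)ᴴ * (S⁻¹ * R) = R * B⁻¹ * Rᴴ := by
      rw [hKH, ← hSS, Matrix.mul_inv_rev, hRH.eq]
      simp only [Matrix.mul_assoc]
    have : Invertible B := hB.isUnit.invertible
    rw [hinv, ← Matrix.PosDef.fromBlocks₂₂ 1 R hB]
    have : Invertible (1 : Matrix (Fin n) (Fin n) ℂ) := invertibleOne
    rw [Matrix.PosDef.fromBlocks₁₁ R B Matrix.PosDef.one, inv_one, Matrix.mul_one, hRH.eq, hRR]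
    exact hAB
  have key := hf.contraction_compression h2h1 hf0 hB.posSemidef hK
  have hKB : (S⁻¹ * R)ᴴ * B * (S⁻¹ * R) = A := by
    simpa [hSS, hRR] using hcancel 1
  rw [hKB, hfA, hfB, hcancel, ← Matrix.sub_mul, ← Matrix.mul_sub] at key
  have := key.conjTranspose_mul_mul_same R⁻¹
  rw [conjTranspose_nonsing_inv, hRH.eq] at this
  simpa [loewnerLE, Matrix.mul_assoc, nonsing_inv_mul R hRdet, mul_nonsing_inv R hRdet,
    nonsing_inv_mul_cancel_left R _ hRdet] using this
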